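/- arXiv:1701.08562 — 2 statements merged into one kernel-verified Lean document; each statement's English description precedes it below -/
import Mathlib

section
/- Let T = △(e(1,0), e(0,1), e(1,1)) with e(1,0)+e(0,1)+e(1,1) = (0,0) and e(0,0) := (0,0). Let X ∈ 𝔽₂^{n×2}, y ∈ T^{(n)}(X), and κ ∈ 𝔽₂²∖{(0,0)}. Then: (i) for all 1 ≤ i < i' ≤ n, both y and y ⊕_{i'} κ lie in T^{(i)}(X); and (ii) for all 1 ≤ i ≤ n, |y ⊕_i κ − y| ≤ 2·d(T)/2^i, where |·| is the Euclidean norm and d(T) the diameter of T. -/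
open MeasureTheory

noncomputable section

/-- The two-element field. -/
abbrev F2 : Type := ZMod 2

/-- Points of the plane. -/
abbrev Pt : Type := EuclideanSpace ℝ (Fin 2)

/-- The (closed) triangle with vertices `A`, `B`, `C`. -/
def tri (A B C : Pt) : Set Pt :=
  {x | ∃ w1 w2 w3 : ℝ, 0 ≤ w1 ∧ 0 ≤ w2 ∧ 0 ≤ w3 ∧ w1 + w2 + w3 = 1 ∧
    x = w1 • A + w2 • B + w3 • C}

/-- One step of the recursive partitioning, acting on vertex triples `(A,B,C)`. -/
def subV (v : Pt × Pt × Pt) (ξ : F2 × F2) : Pt × Pt × Pt :=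
  if ξ = (1, 0) then (v.1, (2:ℝ)⁻¹ • (v.1 + v.2.1), (2:ℝ)⁻¹ • (v.1 + v.2.2))
  else if ξ = (0, 1) then ((2:ℝ)⁻¹ • (v.2.1 + v.1), v.2.1, (2:ℝ)⁻¹ • (v.2.1 + v.2.2))
  else if ξ = (1, 1) then ((2:ℝ)⁻¹ • (v.2.2 + v.1), (2:ℝ)⁻¹ • (v.2.2 + v.2.1), v.2.2)
  else ((2:ℝ)⁻¹ • (v.2.1 + v.2.2), (2:ℝ)⁻¹ • (v.2.2 + v.1), (2:ℝ)⁻¹ • (v.1 + v.2.1))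

/-- Iterated partitioning along a list of pairs of bits (the rows of `X`). -/
def vIter (v : Pt × Pt × Pt) (l : List (F2 × F2)) : Pt × Pt × Pt := l.foldl subV v

/-- The subtriangle `T^{(n)}(X)` where `l` is the list of rows of `X`. -/
def subTri (v : Pt × Pt × Pt) (l : List (F2 × F2)) : Set Pt :=
  tri (vIter v l).1 (vIter v l).2.1 (vIter v l).2.2

/-- The centre `φ^{(n)}(X)` of the subtriangle `T^{(n)}(X)`. -/
def ctr (v : Pt × Pt × Pt) (l : List (F2 × F2)) : Pt :=
  (3:ℝ)⁻¹ • ((vIter v l).1 + (vIter v l).2.1 + (vIter v l).2.2)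

/-- The sign `η_i(X)` (with `i` 1-indexed, `1 ≤ i ≤ n+1`). -/
def eta {n : ℕ} (X : Fin n → F2 × F2) (i : ℕ) : ℝ :=
  (-1 : ℝ) ^ (Finset.univ.filter fun a : Fin n => (a : ℕ) + 1 < i ∧ X a = (0, 0)).card

/-- First coordinate direction. -/
def dir1 : Pt := EuclideanSpace.single 0 1

/-- Second coordinate direction. -/
def dir2 : Pt := EuclideanSpace.single 1 1

/-- Partial derivative (within `T`) of `f` in the direction `v`. -/
def pdW (T : Set Pt) (v : Pt) (f : Pt → ℝ) : Pt → ℝ := fun x => fderivWithin ℝ f T x v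

/-- Sup of `|g|` over `T`. -/
def supAbs (T : Set Pt) (g : Pt → ℝ) : ℝ := ⨆ x ∈ T, |g x|

/-- The norm `‖f‖_{C²(T)}`: the maximum over all partial derivatives of order at most 2
of the sup norm on `T`. -/
def c2Norm (T : Set Pt) (f : Pt → ℝ) : ℝ :=
  max (supAbs T f)
    (max (max (supAbs T (pdW T dir1 f)) (supAbs T (pdW T dir2 f)))
      (max (supAbs T (pdW T dir1 (pdW T dir1 f)))
        (max (supAbs T (pdW T dir2 (pdW T dir1 f)))
          (supAbs T (pdW T dir2 (pdW T dir2 f))))))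

/-- The `n`-th discretized function `F_n` of `f` (with `X` given by its rows). -/
def discF (v : Pt × Pt × Pt) {n : ℕ} (f : Pt → ℝ) (X : Fin n → F2 × F2) : ℝ :=
  (volume (subTri v (List.ofFn X))).toReal⁻¹ * ∫ y in subTri v (List.ofFn X), f y

/-- The `l`-th dyadic digit of `h`. -/
def digit (h l : ℕ) : F2 := if Nat.testBit h l then 1 else 0

/-- The weight `μ₁(k)` of a column vector: the largest (1-indexed) position of a
nonzero entry, and `0` for the zero vector. -/
def mu1 {n : ℕ} (k : Fin n → F2) : ℕ :=
  (Finset.univ.filter fun i : Fin n => k i ≠ 0).sup fun i => (i : ℕ) + 1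

/-- The weight `v(K) = max (μ₁(k₁), μ₁(k₂))` of `K` (given by its rows). -/
def vK {n : ℕ} (K : Fin n → F2 × F2) : ℕ :=
  max (mu1 fun i => (K i).1) (mu1 fun i => (K i).2)

/-- Entry `(i, j)` (0-indexed row `i`) of the point `X(h)` of the digital sequence with
generating matrices `Cm 0`, `Cm 1` (0-indexed). -/
def Xent (Cm : Fin 2 → ℕ → ℕ → F2) (h i : ℕ) (j : Fin 2) : F2 :=
  ∑ l ∈ Finset.range (h + 1), Cm j i l * digit h l

/-- Row `i` (0-indexed) of the point `X(h)` of the digital sequence. -/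
def XrowS (Cm : Fin 2 → ℕ → ℕ → F2) (h i : ℕ) : F2 × F2 :=
  (Xent Cm h i 0, Xent Cm h i 1)

/-- `ν(h)`: the number of initial rows of `X(h)` after which all rows vanish. -/
def nuF (Cm : Fin 2 → ℕ → ℕ → F2) (h : ℕ) : ℕ :=
  sInf {q | ∀ i, q ≤ i → XrowS Cm h i = (0, 0)}

/-- The `h`-th point of the sequence `S_T` in the triangle with vertex triple `v`. -/
def seqPt (v : Pt × Pt × Pt) (Cm : Fin 2 → ℕ → ℕ → F2) (h : ℕ) : Pt :=
  ctr v (List.ofFn fun i : Fin (nuF Cm h) => XrowS Cm h (i : ℕ))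

/-- Row `i` of the digital-net point `X(h)` for generating matrices `C1 C2 ∈ 𝔽₂^{n×m}`. -/
def XnetRow {n m : ℕ} (C1 C2 : Matrix (Fin n) (Fin m) F2) (h : ℕ) (i : Fin n) : F2 × F2 :=
  (∑ l : Fin m, C1 i l * digit h (l : ℕ), ∑ l : Fin m, C2 i l * digit h (l : ℕ))

/-- The Walsh function `wal_K(X)` (for `K`, `X` given by their rows). -/
def walR {n : ℕ} (K X : Fin n → F2 × F2) : ℝ :=
  (-1 : ℝ) ^ (∑ i : Fin n, ((K i).1 * (X i).1 + (K i).2 * (X i).2)).val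

/-- The `K`-th Walsh coefficient of `F : 𝔽₂^{n×2} → ℝ`. -/
def fhat {n : ℕ} (F : (Fin n → F2 × F2) → ℝ) (K : Fin n → F2 × F2) : ℝ :=
  ((4:ℝ) ^ n)⁻¹ * ∑ X : Fin n → F2 × F2, F X * walR K X

/-- The vector `τ(κ, κ')`. -/
def tau (e : F2 × F2 → Pt) (κ κ' : F2 × F2) : Pt :=
  if κ' ≠ (0, 0) ∧ κ' ≠ κ then e (κ + κ') - e κ' else e (κ + κ') + e κ'

/-- The point shift `y ⊕_i κ` on `T^{(n)}(X)` (with `i : Fin n` the 0-indexed row,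
corresponding to the 1-indexed row `i+1` of the paper). -/
def ptShift (e : F2 × F2 → Pt) {n : ℕ} (X : Fin n → F2 × F2) (i : Fin n)
    (κ : F2 × F2) (y : Pt) : Pt :=
  if X i ≠ (0, 0) ∧ X i ≠ κ then
    y + (eta X ((i : ℕ) + 1) / 2 ^ ((i : ℕ) + 1)) • tau e κ (X i)
  else
    (2:ℝ) • ctr (e (1, 0), e (0, 1), e (1, 1)) ((List.ofFn X).take (i : ℕ)) - y +
      (eta X ((i : ℕ) + 1) / 2 ^ ((i : ℕ) + 1)) • tau e κ (X i)

/-- The map `σ : 𝔽₂² → 𝔽₂²`. -/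
def sigF : F2 × F2 → F2 × F2 := fun κ =>
  if κ = (0, 0) then (1, 1) else if κ = (1, 1) then (0, 1) else κ

/-- The two-element set `P(κ) = {p₁(κ), p₂(κ)}`. -/
def pSet (κ : F2 × F2) : Finset (F2 × F2) :=
  if κ = (0, 0) then {(0, 0), (1, 1)} else if κ = (0, 1) then {(1, 1), (1, 0)}
  else if κ = (1, 0) then {(1, 1), (0, 1)} else {(1, 0), (1, 1)}

/-- The one-row Walsh function `wal_κ(ξ)`. -/
def walRow (κ ξ : F2 × F2) : ℝ := (-1 : ℝ) ^ ((κ.1 * ξ.1 + κ.2 * ξ.2 : F2)).val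

/-- The `i`-th dyadic difference `d_K^{(i)} F` (with `i : Fin n` 0-indexed, corresponding
to the 1-indexed index `i+1` of the paper). -/
def dd {n : ℕ} (K : Fin n → F2 × F2) (i : Fin n) (F : (Fin n → F2 × F2) → ℝ) :
    (Fin n → F2 × F2) → ℝ :=
  fun X => F (Function.update X i (X i + sigF (K i))) + walRow (K i) (sigF (K i)) * F X

/-- The subset `R_w(K) ⊆ 𝔽₂^{n×2}` (here `w : ℕ` is the 1-indexed paper index,
`0 ≤ w ≤ v(K)-1`). -/
def Rset {n : ℕ} (K : Fin n → F2 × F2) (w : ℕ) : Finset (Fin n → F2 × F2) :=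
  Finset.univ.filter fun X =>
    (∀ i : Fin n, w ≤ (i : ℕ) → (i : ℕ) + 1 < vK K → X i ∉ pSet (K i)) ∧
    (w = 0 ∨ ∃ j : Fin n, (j : ℕ) + 1 = w ∧ X j ∈ pSet (K j))

/-- The Walsh coefficient of `F` on the subset `R_w(K)`. -/
def rwHat {n : ℕ} (F : (Fin n → F2 × F2) → ℝ) (K : Fin n → F2 × F2) (w : ℕ) : ℝ :=
  ((4:ℝ) ^ n)⁻¹ * ∑ X ∈ Rset K w, F X * walR K X

theorem F2_pair_cases (ξ : F2 × F2) :
    ξ = (0, 0) ∨ ξ = (1, 0) ∨ ξ = (0, 1) ∨ ξ = (1, 1) := by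
  revert ξ; decide

/-- The vertex triple of the homothetic copy `c + s • T` of the triangle with vertices `e κ`. -/
def homothetV (e : F2 × F2 → Pt) (c : Pt) (s : ℝ) : Pt × Pt × Pt :=
  (c + s • e (1, 0), c + s • e (0, 1), c + s • e (1, 1))

theorem subV_homothetV {e : F2 × F2 → Pt} (he0 : e (0, 0) = 0)
    (hsum : e (1, 0) + e (0, 1) + e (1, 1) = 0) (c : Pt) (s : ℝ) (ξ : F2 × F2) :
    subV (homothetV e c s) ξ =
      homothetV e (c + (s / 2) • e ξ) (if ξ = (0, 0) then -(s / 2) else s / 2) := by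
  have h : e (1, 1) = -(e (1, 0) + e (0, 1)) := by
    rw [eq_neg_iff_add_eq_zero, ← hsum]; abel
  rcases F2_pair_cases ξ with rfl | rfl | rfl | rfl <;>
    simp only [subV, homothetV, he0, h, Prod.mk.injEq, zero_ne_one, one_ne_zero, if_true,
      if_false, and_true, and_false] <;>
    refine ⟨?_, ?_, ?_⟩ <;> module

theorem mem_tri_homothetV {e : F2 × F2 → Pt} {c : Pt} {s : ℝ} {y : Pt} :
    y ∈ tri (homothetV e c s).1 (homothetV e c s).2.1 (homothetV e c s).2.2 ↔
      ∃ z ∈ tri (e (1, 0)) (e (0, 1)) (e (1, 1)), y = c + s • z := by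
  have key (w₁ w₂ w₃ : ℝ) (h : w₁ + w₂ + w₃ = 1) :
      w₁ • (c + s • e (1, 0)) + w₂ • (c + s • e (0, 1)) + w₃ • (c + s • e (1, 1)) =
        c + s • (w₁ • e (1, 0) + w₂ • e (0, 1) + w₃ • e (1, 1)) := by
    obtain rfl : w₃ = 1 - w₁ - w₂ := by linarith
    module
  constructor
  · rintro ⟨w₁, w₂, w₃, h₁, h₂, h₃, h, rfl⟩
    exact ⟨_, ⟨w₁, w₂, w₃, h₁, h₂, h₃, h, rfl⟩, key w₁ w₂ w₃ h⟩
  · rintro ⟨_, ⟨w₁, w₂, w₃, h₁, h₂, h₃, h, rfl⟩, rfl⟩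
    exact ⟨w₁, w₂, w₃, h₁, h₂, h₃, h, (key w₁ w₂ w₃ h).symm⟩

theorem half_add_vertex_mem_tri {e : F2 × F2 → Pt} {z : Pt}
    (hz : z ∈ tri (e (1, 0)) (e (0, 1)) (e (1, 1))) {κ : F2 × F2} (hκ : κ ≠ (0, 0)) :
    (2⁻¹ : ℝ) • (e κ + z) ∈ tri (e (1, 0)) (e (0, 1)) (e (1, 1)) := by
  obtain ⟨w₁, w₂, w₃, h₁, h₂, h₃, h, rfl⟩ := hz
  rcases F2_pair_cases κ with rfl | rfl | rfl | rfl
  · exact absurd rfl hκ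
  · exact ⟨(1 + w₁) / 2, w₂ / 2, w₃ / 2, by linarith, by linarith, by linarith, by linarith,
      by module⟩
  · exact ⟨w₁ / 2, (1 + w₂) / 2, w₃ / 2, by linarith, by linarith, by linarith, by linarith,
      by module⟩
  · exact ⟨w₁ / 2, w₂ / 2, (1 + w₃) / 2, by linarith, by linarith, by linarith, by linarith,
      by module⟩

theorem neg_half_mem_tri {A B C z : Pt} (hsum : A + B + C = 0) (hz : z ∈ tri A B C) :
    (-2⁻¹ : ℝ) • z ∈ tri A B C := by
  obtain ⟨w₁, w₂, w₃, h₁, h₂, h₃, h, rfl⟩ := hz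
  obtain rfl : C = -(A + B) := by rw [eq_neg_iff_add_eq_zero, ← hsum]; abel
  exact ⟨(1 - w₁) / 2, (1 - w₂) / 2, (1 - w₃) / 2, by linarith, by linarith, by linarith,
    by linarith, by module⟩

theorem tri_subV_homothetV_subset {e : F2 × F2 → Pt} (he0 : e (0, 0) = 0)
    (hsum : e (1, 0) + e (0, 1) + e (1, 1) = 0) (c : Pt) (s : ℝ) (ξ : F2 × F2) :
    tri (subV (homothetV e c s) ξ).1 (subV (homothetV e c s) ξ).2.1
        (subV (homothetV e c s) ξ).2.2 ⊆
      tri (homothetV e c s).1 (homothetV e c s).2.1 (homothetV e c s).2.2 := by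
  intro y hy
  rw [subV_homothetV he0 hsum, mem_tri_homothetV] at hy
  obtain ⟨z, hz, rfl⟩ := hy
  rw [mem_tri_homothetV]
  by_cases hξ : ξ = (0, 0)
  · subst hξ
    exact ⟨_, neg_half_mem_tri hsum hz, by simp only [he0, if_true]; module⟩
  · exact ⟨_, half_add_vertex_mem_tri hz hξ, by simp only [hξ, if_false]; module⟩

theorem isBounded_tri (A B C : Pt) : Bornology.IsBounded (tri A B C) := by
  refine (Metric.isBounded_closedBall (x := (0 : Pt)) (r := ‖A‖ + ‖B‖ + ‖C‖)).subset ?_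
  rintro _ ⟨w₁, w₂, w₃, h₁, h₂, h₃, h, rfl⟩
  rw [mem_closedBall_zero_iff]
  refine (norm_add₃_le).trans ?_
  rw [norm_smul, norm_smul, norm_smul, Real.norm_of_nonneg h₁, Real.norm_of_nonneg h₂,
    Real.norm_of_nonneg h₃]
  gcongr <;> exact mul_le_of_le_one_left (norm_nonneg _) (by linarith)

theorem norm_sub_le_of_mem_tri_homothetV {e : F2 × F2 → Pt} {c : Pt} {s : ℝ} {x y : Pt}
    (hx : x ∈ tri (homothetV e c s).1 (homothetV e c s).2.1 (homothetV e c s).2.2)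
    (hy : y ∈ tri (homothetV e c s).1 (homothetV e c s).2.1 (homothetV e c s).2.2) :
    ‖x - y‖ ≤ |s| * Metric.diam (tri (e (1, 0)) (e (0, 1)) (e (1, 1))) := by
  obtain ⟨z, hz, rfl⟩ := mem_tri_homothetV.1 hx
  obtain ⟨z', hz', rfl⟩ := mem_tri_homothetV.1 hy
  rw [add_sub_add_left_eq_sub, ← smul_sub, norm_smul, Real.norm_eq_abs, ← dist_eq_norm]
  gcongr
  exact Metric.dist_le_diam_of_mem (isBounded_tri _ _ _) hz hz'

theorem eta_succ {n : ℕ} (X : Fin n → F2 × F2) (i : Fin n) :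
    eta X ((i : ℕ) + 2) = if X i = (0, 0) then -eta X ((i : ℕ) + 1) else eta X ((i : ℕ) + 1) := by
  unfold eta
  split_ifs with h
  · have : (Finset.univ.filter fun a : Fin n => (a : ℕ) + 1 < (i : ℕ) + 2 ∧ X a = (0, 0)) =
        insert i
          (Finset.univ.filter fun a : Fin n => (a : ℕ) + 1 < (i : ℕ) + 1 ∧ X a = (0, 0)) := by
      ext a
      simp only [Finset.mem_filter, Finset.mem_univ, true_and, Finset.mem_insert, Fin.ext_iff]
      constructor
      · rintro ⟨h₁, h₂⟩
        by_cases ha : (a : ℕ) = i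
        · exact Or.inl ha
        · exact Or.inr ⟨by omega, h₂⟩
      · rintro (h₁ | ⟨h₁, h₂⟩)
        · exact ⟨by omega, by rwa [Fin.ext h₁]⟩
        · exact ⟨by omega, h₂⟩
    rw [this, Finset.card_insert_of_notMem (by simp), pow_succ, mul_neg_one]
  · congr 2
    ext a
    simp only [Finset.mem_filter, Finset.mem_univ, true_and]
    refine and_congr_left fun ha => ⟨fun h₁ => ?_, fun h₁ => by omega⟩
    have : (a : ℕ) ≠ i := fun h₂ => h (by rwa [← Fin.ext h₂])
    omega

theorem abs_eta {n : ℕ} (X : Fin n → F2 × F2) (i : ℕ) : |eta X i| = 1 := by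
  simp [eta]

theorem vIter_take_succ (v : Pt × Pt × Pt) {n : ℕ} (X : Fin n → F2 × F2) (i : Fin n) :
    vIter v ((List.ofFn X).take ((i : ℕ) + 1)) =
      subV (vIter v ((List.ofFn X).take (i : ℕ))) (X i) := by
  rw [List.take_succ_eq_append_getElem (by simp)]
  simp [vIter]

theorem ctr_eq_of_vIter {e : F2 × F2 → Pt} (hsum : e (1, 0) + e (0, 1) + e (1, 1) = 0)
    {v : Pt × Pt × Pt} {l : List (F2 × F2)} {c : Pt} {s : ℝ}
    (h : vIter v l = homothetV e c s) : ctr v l = c := by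
  have h' : e (1, 1) = -(e (1, 0) + e (0, 1)) := by
    rw [eq_neg_iff_add_eq_zero, ← hsum]; abel
  rw [ctr, h]
  simp only [homothetV, h']
  module

theorem vIter_take_eq_homothetV {e : F2 × F2 → Pt} (he0 : e (0, 0) = 0)
    (hsum : e (1, 0) + e (0, 1) + e (1, 1) = 0) {n : ℕ} (X : Fin n → F2 × F2) {i : ℕ}
    (hi : i ≤ n) :
    vIter (e (1, 0), e (0, 1), e (1, 1)) ((List.ofFn X).take i) =
      homothetV e (ctr (e (1, 0), e (0, 1), e (1, 1)) ((List.ofFn X).take i))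
        (eta X (i + 1) / 2 ^ i) := by
  suffices h : ∃ c, vIter (e (1, 0), e (0, 1), e (1, 1)) ((List.ofFn X).take i) =
      homothetV e c (eta X (i + 1) / 2 ^ i) by
    obtain ⟨c, hc⟩ := h
    rwa [ctr_eq_of_vIter hsum hc]
  induction i with
  | zero => exact ⟨0, by simp [vIter, homothetV, eta]⟩
  | succ i ih =>
    obtain ⟨c, hc⟩ := ih (by omega)
    have hstep := vIter_take_succ (e (1, 0), e (0, 1), e (1, 1)) X ⟨i, hi⟩
    have heta := eta_succ X ⟨i, hi⟩
    simp only at hstep heta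
    refine ⟨c + (eta X (i + 1) / 2 ^ i / 2) • e (X ⟨i, hi⟩), hstep.trans ?_⟩
    rw [hc, subV_homothetV he0 hsum, heta]
    congr 1
    split_ifs <;> ring

theorem subTri_take_antitone {e : F2 × F2 → Pt} (he0 : e (0, 0) = 0)
    (hsum : e (1, 0) + e (0, 1) + e (1, 1) = 0) {n : ℕ} (X : Fin n → F2 × F2) {i j : ℕ}
    (hij : i ≤ j) (hj : j ≤ n) :
    subTri (e (1, 0), e (0, 1), e (1, 1)) ((List.ofFn X).take j) ⊆
      subTri (e (1, 0), e (0, 1), e (1, 1)) ((List.ofFn X).take i) := by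
  induction j, hij using Nat.le_induction with
  | base => exact subset_rfl
  | succ j _ ih =>
    refine subset_trans ?_ (ih (by omega))
    have hstep := vIter_take_succ (e (1, 0), e (0, 1), e (1, 1)) X ⟨j, hj⟩
    simp only at hstep
    rw [subTri, subTri, hstep, vIter_take_eq_homothetV he0 hsum X (by omega)]
    exact tri_subV_homothetV_subset he0 hsum _ _ _

/-- A shift in row `i` stays within the triangle determined by the preceding rows. -/
theorem ptShift_mem_subTri_take {e : F2 × F2 → Pt} (he0 : e (0, 0) = 0)
    (hsum : e (1, 0) + e (0, 1) + e (1, 1) = 0) {n : ℕ} (X : Fin n → F2 × F2) (i : Fin n)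
    {y : Pt} (hy : y ∈ subTri (e (1, 0), e (0, 1), e (1, 1)) ((List.ofFn X).take ((i : ℕ) + 1)))
    {κ : F2 × F2} (hκ : κ ≠ (0, 0)) :
    ptShift e X i κ y ∈ subTri (e (1, 0), e (0, 1), e (1, 1)) ((List.ofFn X).take (i : ℕ)) := by
  have hs : eta X ((i : ℕ) + 1) / 2 ^ ((i : ℕ) + 1) = eta X ((i : ℕ) + 1) / 2 ^ (i : ℕ) / 2 := by
    rw [pow_succ, div_div]
  have hself (ξ : F2 × F2) : ξ + ξ = (0, 0) := by revert ξ; decide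
  have hne : ∀ ξ : F2 × F2, ξ ≠ κ → κ + ξ ≠ (0, 0) := by revert κ; decide
  rw [subTri, vIter_take_succ, vIter_take_eq_homothetV he0 hsum X i.2.le,
    subV_homothetV he0 hsum, mem_tri_homothetV] at hy
  obtain ⟨z, hz, rfl⟩ := hy
  rw [subTri, vIter_take_eq_homothetV he0 hsum X i.2.le, mem_tri_homothetV, ptShift, hs]
  generalize ctr (e (1, 0), e (0, 1), e (1, 1)) ((List.ofFn X).take (i : ℕ)) = c
  generalize eta X ((i : ℕ) + 1) / 2 ^ (i : ℕ) = s
  generalize X i = ξ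
  by_cases h0 : ξ = (0, 0)
  · subst h0
    refine ⟨_, half_add_vertex_mem_tri hz hκ, ?_⟩
    have : κ + (0, 0) = κ := add_zero κ
    simp only [tau, ne_eq, not_true_eq_false, false_and, if_false, if_true, he0, this]
    module
  · by_cases h1 : ξ = κ
    · subst h1
      refine ⟨_, neg_half_mem_tri hsum hz, ?_⟩
      simp only [tau, ne_eq, not_true_eq_false, and_false, if_false, h0, he0, hself]
      module
    · refine ⟨_, half_add_vertex_mem_tri hz (hne ξ h1), ?_⟩
      simp only [tau, ne_eq, h0, h1, not_false_eq_true, and_self, if_true, if_false]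
      module

/-- Lemma 6, part 3. For `y ∈ T^{(n)}(X)`: (i) for `i < i'` both `y`
and `y ⊕_{i'} κ` lie in `T^{(i)}(X)`, and (ii) `|y ⊕_i κ - y| ≤ 2 d(T) / 2^i`.
(Here `i, i' : Fin n` are 0-indexed rows, corresponding to the paper's `i+1`, `i'+1`.) -/
theorem statement15 (e : F2 × F2 → Pt) (he0 : e (0, 0) = 0)
    (hsum : e (1, 0) + e (0, 1) + e (1, 1) = 0)
    {n : ℕ} (X : Fin n → F2 × F2) (y : Pt)
    (hy : y ∈ subTri (e (1, 0), e (0, 1), e (1, 1)) (List.ofFn X))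
    (κ : F2 × F2) (hκ : κ ≠ (0, 0)) :
    (∀ i i' : Fin n, (i : ℕ) < (i' : ℕ) →
      y ∈ subTri (e (1, 0), e (0, 1), e (1, 1)) ((List.ofFn X).take ((i : ℕ) + 1)) ∧
      ptShift e X i' κ y ∈
        subTri (e (1, 0), e (0, 1), e (1, 1)) ((List.ofFn X).take ((i : ℕ) + 1))) ∧
    (∀ i : Fin n, ‖ptShift e X i κ y - y‖ ≤
      2 * Metric.diam (tri (e (1, 0)) (e (0, 1)) (e (1, 1))) / 2 ^ ((i : ℕ) + 1)) := by
  have hy' {i : ℕ} (hi : i ≤ n) :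
      y ∈ subTri (e (1, 0), e (0, 1), e (1, 1)) ((List.ofFn X).take i) := by
    refine subTri_take_antitone he0 hsum X hi le_rfl ?_
    rwa [List.take_of_length_le (by simp)]
  have hshift (i : Fin n) := ptShift_mem_subTri_take he0 hsum X i (hy' i.2) hκ
  refine ⟨fun i i' hii' => ⟨hy' i.2, subTri_take_antitone he0 hsum X hii' i'.2.le (hshift i')⟩,
    fun i => ?_⟩
  have hx := hshift i
  have hy := hy' i.2.le
  rw [subTri, vIter_take_eq_homothetV he0 hsum X i.2.le] at hx hy
  refine (norm_sub_le_of_mem_tri_homothetV hx hy).trans_eq ?_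
  rw [abs_div, abs_eta, abs_of_pos (by positivity), pow_succ]
  field_simp
end
end

section
/- Let F : 𝔽₂^{n×2} → ℝ and K = (κ_i)_{i=1}^n ∈ 𝔽₂^{n×2}∖{0} with rows κ_i. Then for every 0 ≤ w ≤ v(K)−1, R_w F̂(K) = −(1/2)·R_w (d_K^{(v(K))}F)^(K), i.e. the Walsh coefficient of F on R_w(K) equals −1/2 times the Walsh coefficient on R_w(K) of the v(K)-th dyadic difference of F. -/
open MeasureTheory

noncomputable section

lemma neg_one_pow_val_add (a b : F2) :
    (-1 : ℝ) ^ (a + b).val = (-1 : ℝ) ^ a.val * (-1 : ℝ) ^ b.val := by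
  rw [ZMod.val_add, ← pow_add, ← neg_one_pow_eq_pow_mod_two]

lemma walR_update_add {n : ℕ} (K X : Fin n → F2 × F2) (i : Fin n) (s : F2 × F2) :
    walR K (Function.update X i (X i + s)) = walRow (K i) s * walR K X := by
  unfold walR walRow
  rw [← neg_one_pow_val_add]
  congr 2
  rw [← Finset.add_sum_erase _ _ (Finset.mem_univ i),
    ← Finset.add_sum_erase _ (fun j => (K j).1 * (X j).1 + (K j).2 * (X j).2)
      (Finset.mem_univ i),
    Finset.sum_congr rfl fun j hj => by
      rw [Function.update_of_ne (Finset.ne_of_mem_erase hj)]]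
  simp only [Function.update_self, Prod.fst_add, Prod.snd_add]
  ring

lemma walRow_sigF {κ : F2 × F2} (h : κ ≠ 0) : walRow κ (sigF κ) = -1 := by
  have key : ∀ κ : F2 × F2, κ ≠ 0 → κ.1 * (sigF κ).1 + κ.2 * (sigF κ).2 = 1 := by
    unfold sigF
    decide
  rw [walRow, key κ h, ZMod.val_one, pow_one]

lemma apply_ne_zero_of_mu1_eq {n : ℕ} {k : Fin n → F2} {i : Fin n}
    (h : (i : ℕ) + 1 = mu1 k) : k i ≠ 0 := by
  unfold mu1 at h
  obtain hs | hs := (Finset.univ.filter fun i : Fin n => k i ≠ 0).eq_empty_or_nonempty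
  · simp [hs] at h
  · obtain ⟨j, hj, hjs⟩ := Finset.exists_mem_eq_sup _ hs fun i : Fin n => (i : ℕ) + 1
    rw [hjs] at h
    obtain rfl : i = j := Fin.ext (by omega)
    exact (Finset.mem_filter.1 hj).2

lemma apply_ne_zero_of_vK_eq {n : ℕ} {K : Fin n → F2 × F2} {i : Fin n}
    (h : (i : ℕ) + 1 = vK K) : K i ≠ 0 := by
  intro h0
  obtain h1 | h1 := max_choice (mu1 fun i => (K i).1) (mu1 fun i => (K i).2)
  · exact apply_ne_zero_of_mu1_eq (h.trans h1) (by simp [h0])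
  · exact apply_ne_zero_of_mu1_eq (h.trans h1) (by simp [h0])

lemma update_mem_Rset {n : ℕ} {K X : Fin n → F2 × F2} {i : Fin n} {w : ℕ}
    (hi : (i : ℕ) + 1 = vK K) (hw : w < vK K) (hX : X ∈ Rset K w) (ξ : F2 × F2) :
    Function.update X i ξ ∈ Rset K w := by
  simp only [Rset, Finset.mem_filter, Finset.mem_univ, true_and] at hX ⊢
  refine ⟨fun j hj hjv => ?_, hX.2.imp_right ?_⟩
  · rw [Function.update_of_ne (by rintro rfl; omega)]
    exact hX.1 j hj hjv
  · rintro ⟨j, hj, hjP⟩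
    refine ⟨j, hj, ?_⟩
    rwa [Function.update_of_ne (by rintro rfl; omega)]

lemma update_add_update_add {n : ℕ} (X : Fin n → F2 × F2) (i : Fin n) (s : F2 × F2) :
    Function.update (Function.update X i (X i + s)) i
      (Function.update X i (X i + s) i + s) = X := by
  have hs : s + s = 0 := Prod.ext (CharTwo.add_self_eq_zero _) (CharTwo.add_self_eq_zero _)
  simp [add_assoc, hs]

/-- Lemma 7, part 1. For `0 ≤ w ≤ v(K) - 1`, the Walsh coefficient of
`F` on `R_w(K)` equals `-1/2` times that of the `v(K)`-th dyadic difference of `F`.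
(Here `iv : Fin n` is the 0-indexed row with `(iv : ℕ) + 1 = v(K)`.) -/
theorem statement16 {n : ℕ} (F : (Fin n → F2 × F2) → ℝ) (K : Fin n → F2 × F2)
    (hK : K ≠ 0) (iv : Fin n) (hiv : (iv : ℕ) + 1 = vK K) (w : ℕ) (hw : w < vK K) :
    rwHat F K w = -(1 / 2) * rwHat (dd K iv F) K w := by
  have hwal := walRow_sigF (apply_ne_zero_of_vK_eq hiv)
  have hshift : ∑ X ∈ Rset K w, F (Function.update X iv (X iv + sigF (K iv))) * walR K X =
      -∑ X ∈ Rset K w, F X * walR K X := by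
    rw [← Finset.sum_neg_distrib]
    refine Finset.sum_bij' (fun X _ => Function.update X iv (X iv + sigF (K iv)))
      (fun X _ => Function.update X iv (X iv + sigF (K iv)))
      (fun X hX => update_mem_Rset hiv hw hX _) (fun X hX => update_mem_Rset hiv hw hX _)
      (fun X _ => update_add_update_add X iv _) (fun X _ => update_add_update_add X iv _)
      fun X _ => ?_
    rw [walR_update_add, hwal]
    ring
  simp only [rwHat, dd, hwal, add_mul, Finset.sum_add_distrib, hshift, neg_mul, one_mul,
    Finset.sum_neg_distrib]
  ring
end
end
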